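/- For any nonnegative integer r, t({2}^r, 3) = (-2/(2r+1)!) · (π/2)^{2r+2} · ∑_{n=0}^{∞} ζ(2n) / ((2n+2r+1)(2n+2r+2)·2^{2n}). -/

import Mathlib

/-- The multiple zeta value `ζ(s₁,…,s_l) = ∑_{1 ≤ k₁ < ⋯ < k_l} ∏ 1/kᵢ^{sᵢ}`. -/
noncomputable def MZV (s : List ℕ) : ℝ :=
  ∑' f : {f : Fin s.length → ℕ+ // StrictMono f},
    ∏ i : Fin s.length, (1 : ℝ) / ((f.1 i : ℕ) : ℝ) ^ s.get i

/-- The multiple t-value `t(s₁,…,s_l) = ∑_{1 ≤ k₁ < ⋯ < k_l} ∏ 1/(2kᵢ-1)^{sᵢ}`. -/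
noncomputable def MTV (s : List ℕ) : ℝ :=
  ∑' f : {f : Fin s.length → ℕ+ // StrictMono f},
    ∏ i : Fin s.length, (1 : ℝ) / ((2 * (f.1 i : ℕ) - 1 : ℕ) : ℝ) ^ s.get i

open Filter Topology MeasureTheory
open scoped ENNReal

/-- The truncated multiple t-value `∑_{0 ≤ j₁ < ⋯ < j_r < k} ∏ 1/(2jᵢ+1)²`. -/
noncomputable def truncT : ℕ → ℕ → ℝ
  | 0, _ => 1
  | r + 1, k => ∑ j ∈ Finset.range k, truncT r j / (2 * j + 1) ^ 2

lemma truncT_nonneg (r k : ℕ) : 0 ≤ truncT r k := by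
  induction r generalizing k with
  | zero => simp [truncT]
  | succ r ih => exact Finset.sum_nonneg fun j _ => div_nonneg (ih j) (by positivity)

lemma strictMono_snoc_iff {α : Type*} [Preorder α] {n : ℕ} (f : Fin (n + 1) → α) (a : α) :
    StrictMono (Fin.snoc f a : Fin (n + 2) → α) ↔ StrictMono f ∧ f (Fin.last n) < a := by
  constructor
  · intro h
    refine ⟨fun i j hij => ?_, ?_⟩
    · simpa using h (Fin.castSucc_lt_castSucc_iff.2 hij)
    · simpa using h (Fin.castSucc_lt_last (Fin.last n))
  · rintro ⟨hf, ha⟩ i j hij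
    induction j using Fin.lastCases with
    | last =>
      induction i using Fin.lastCases with
      | last => exact absurd hij (lt_irrefl _)
      | cast i => simpa using (hf.monotone (Fin.le_last i)).trans_lt ha
    | cast j =>
      induction i using Fin.lastCases with
      | last => exact absurd hij (Fin.le_last _).not_gt
      | cast i => simpa using hf (Fin.castSucc_lt_castSucc_iff.1 hij)

open Classical in
/-- Summing over strictly increasing tuples by peeling off the largest entry. -/
lemma tsum_strictMono_snoc {n : ℕ} (F : (Fin (n + 2) → ℕ+) → ℝ≥0∞) :
    ∑' f : {f : Fin (n + 2) → ℕ+ // StrictMono f}, F f =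
      ∑' f : {f : Fin (n + 1) → ℕ+ // StrictMono f}, ∑' k : ℕ+,
        if f.1 (Fin.last n) < k then F (Fin.snoc f.1 k) else 0 := by
  refine (tsum_subtype {f : Fin (n + 2) → ℕ+ | StrictMono f} F).trans (Eq.trans ?_
    (tsum_subtype {f : Fin (n + 1) → ℕ+ | StrictMono f} (fun f => ∑' k : ℕ+,
        if f (Fin.last n) < k then F (Fin.snoc f k) else 0)).symm)
  rw [← (Fin.snocEquiv (fun _ : Fin (n + 2) => ℕ+)).tsum_eq, ENNReal.tsum_prod', ENNReal.tsum_comm]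
  refine tsum_congr fun f => ?_
  by_cases hf : StrictMono f <;>
    simp [Set.indicator_apply, Fin.snocEquiv, strictMono_snoc_iff, hf]

open Classical in
lemma tsum_strictMono_prod (w : ℕ+ → ℝ≥0∞) (T : ℕ → ℕ+ → ℝ≥0∞) (h0 : ∀ k, T 0 k = 1)
    (hT : ∀ r k, T (r + 1) k = ∑' j, if j < k then T r j * w j else 0) (r : ℕ)
    (g : ℕ+ → ℝ≥0∞) :
    ∑' f : {f : Fin (r + 1) → ℕ+ // StrictMono f},
      (∏ i : Fin r, w (f.1 i.castSucc)) * g (f.1 (Fin.last r)) = ∑' k, T r k * g k := by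
  induction r generalizing g with
  | zero =>
    rw [← ((Equiv.subtypeUnivEquiv fun f : Fin 1 → ℕ+ => Subsingleton.strictMono f).trans
      (Equiv.funUnique (Fin 1) ℕ+)).tsum_eq]
    simp [h0]
  | succ r ih =>
    rw [tsum_strictMono_snoc (fun f => (∏ i : Fin (r + 1), w (f i.castSucc)) * g (f (Fin.last _)))]
    have := ih (fun j => w j * ∑' k, if j < k then g k else 0)
    calc _ = ∑' f : {f : Fin (r + 1) → ℕ+ // StrictMono f},
          (∏ i : Fin r, w (f.1 i.castSucc)) * (w (f.1 (Fin.last r)) *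
            ∑' k, if f.1 (Fin.last r) < k then g k else 0) := by
          refine tsum_congr fun f => ?_
          rw [← mul_assoc, ← ENNReal.tsum_mul_left]
          refine tsum_congr fun k => ?_
          simp [Fin.prod_univ_castSucc]
      _ = _ := by
          rw [this]
          simp_rw [hT, ← ENNReal.tsum_mul_left, ← ENNReal.tsum_mul_right]
          rw [ENNReal.tsum_comm]
          refine tsum_congr fun k => tsum_congr fun j => ?_
          split_ifs <;> simp [mul_assoc]

lemma MTV_eq_tsum_of_length (s : List ℕ) (n : ℕ) (h : s.length = n) :
    MTV s = ∑' f : {f : Fin n → ℕ+ // StrictMono f},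
      ∏ i : Fin n, (1 : ℝ) / ((2 * (f.1 i : ℕ) - 1 : ℕ) : ℝ) ^ s.get (i.cast h.symm) := by
  subst h
  rfl

lemma MTV_replicate_two_append_three (r : ℕ) :
    MTV (List.replicate r 2 ++ [3]) = ∑' k : ℕ, truncT r k / (2 * k + 1) ^ 3 := by
  classical
  rw [MTV_eq_tsum_of_length _ (r + 1) (by simp)]
  have key := tsum_strictMono_prod (fun k => ENNReal.ofReal (1 / ((2 * (k : ℕ) - 1 : ℕ) : ℝ) ^ 2))
    (fun r k => ENNReal.ofReal (truncT r k.natPred)) (by simp [truncT]) (fun r k => by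
      rw [truncT, ENNReal.ofReal_sum_of_nonneg
          fun j _ => div_nonneg (truncT_nonneg r j) (by positivity),
        ← Equiv.pnatEquivNat.symm.tsum_eq, tsum_eq_sum (s := Finset.range k.natPred)]
      · refine Finset.sum_congr rfl fun j hj => ?_
        have hjk : j.succPNat < k := by
          rw [← PNat.coe_lt_coe, Nat.succPNat_coe]
          have := PNat.natPred_add_one k
          rw [Finset.mem_range] at hj
          omega
        have : 2 * (j + 1) - 1 = 2 * j + 1 := by omega
        simp only [Equiv.pnatEquivNat_symm_apply, hjk, if_true, Nat.natPred_succPNat,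
          Nat.succPNat_coe, Nat.succ_eq_add_one, this]
        rw [← ENNReal.ofReal_mul (truncT_nonneg _ _)]
        push_cast
        rw [mul_one_div]
      · intro j hj
        have hjk : ¬ j.succPNat < k := by
          rw [← PNat.coe_lt_coe, Nat.succPNat_coe]
          have := PNat.natPred_add_one k
          rw [Finset.mem_range] at hj
          omega
        simp only [Equiv.pnatEquivNat_symm_apply, hjk, if_false]) r
    (fun k => ENNReal.ofReal (1 / ((2 * (k : ℕ) - 1 : ℕ) : ℝ) ^ 3))
  have key' := congrArg ENNReal.toReal key
  rw [ENNReal.tsum_toReal_eq (fun _ => ENNReal.mul_ne_top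
      (ENNReal.prod_ne_top fun _ _ => ENNReal.ofReal_ne_top) ENNReal.ofReal_ne_top),
    ENNReal.tsum_toReal_eq (fun _ => ENNReal.mul_ne_top ENNReal.ofReal_ne_top
      ENNReal.ofReal_ne_top), ← Equiv.pnatEquivNat.symm.tsum_eq] at key'
  convert key' using 1
  · refine tsum_congr fun f => ?_
    rw [Fin.prod_univ_castSucc, ENNReal.toReal_mul, ENNReal.toReal_prod,
      ENNReal.toReal_ofReal (by positivity)]
    congr 1
    · refine Finset.prod_congr rfl fun i _ => ?_
      rw [ENNReal.toReal_ofReal (by positivity)]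
      simp
    · simp
  · refine tsum_congr fun k => ?_
    have : 2 * (k + 1) - 1 = 2 * k + 1 := by omega
    simp only [Equiv.pnatEquivNat_symm_apply, Nat.natPred_succPNat,
          Nat.succPNat_coe, Nat.succ_eq_add_one, this]
    rw [ENNReal.toReal_mul, ENNReal.toReal_ofReal (truncT_nonneg _ _),
      ENNReal.toReal_ofReal (by positivity)]
    push_cast
    rw [mul_one_div]

lemma hasSum_tsum_even_pow_mul_pow {y : ℝ} (hy0 : 0 < y) (hy1 : y < 1) :
    HasSum (fun m : ℕ => (∑' n : ℕ, 1 / ((n : ℝ) + 1) ^ (2 * (m + 1))) * y ^ (2 * (m + 1)))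
      ((1 - Real.pi * y * Real.cot (Real.pi * y)) / 2) := by
  have hq : ∀ n : ℕ, (y / (n + 1)) ^ 2 < 1 := fun n => by
    have h1 : y / ((n : ℝ) + 1) < 1 := by
      rw [div_lt_one (by positivity)]; linarith [(Nat.cast_nonneg n : (0 : ℝ) ≤ n)]
    exact pow_lt_one₀ (by positivity) h1 two_ne_zero
  have hrow : ∀ n : ℕ, HasSum (fun m : ℕ => ((y / (n + 1)) ^ 2) ^ (m + 1))
      (y ^ 2 / ((n + 1) ^ 2 - y ^ 2)) := fun n => by
    have h := (hasSum_geometric_of_lt_one (by positivity) (hq n)).mul_left ((y / (n + 1)) ^ 2)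
    have h2 : ((n : ℝ) + 1) ^ 2 - y ^ 2 ≠ 0 := by
      have := (Nat.cast_nonneg n : (0 : ℝ) ≤ n)
      nlinarith
    convert! h using 1
    · funext m; ring
    · have h3 : (1 : ℝ) - (y / (n + 1)) ^ 2 ≠ 0 := by linarith [hq n]
      field_simp
  have hcol : HasSum (fun n : ℕ => y ^ 2 / (((n : ℝ) + 1) ^ 2 - y ^ 2))
      ((1 - Real.pi * y * Real.cot (Real.pi * y)) / 2) := by
    have hz : (y : ℂ) ∈ Complex.integerComplement := by
      rintro ⟨k, hk⟩
      have hk' : (k : ℝ) = y := by exact_mod_cast hk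
      rw [← hk'] at hy0 hy1
      have h1 : 0 < k := by exact_mod_cast hy0
      have h2 : k < 1 := by exact_mod_cast hy1
      omega
    have h := ((summable_cotTerm hz).hasSum_iff_tendsto_nat.mpr
      (tendsto_logDeriv_euler_cot_sub hz)).mul_left (-(y : ℂ) / 2)
    rw [← Complex.hasSum_ofReal]
    convert! h using 1
    · funext n
      rw [cotTerm_identity hz]
      push_cast
      have h1 : (y : ℂ) + (n + 1) ≠ 0 := by
        exact_mod_cast (by positivity : y + ((n : ℝ) + 1) ≠ 0)
      have h2 : (y : ℂ) - (n + 1) ≠ 0 := by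
        have := (Nat.cast_nonneg n : (0 : ℝ) ≤ n)
        exact_mod_cast (by linarith : y - ((n : ℝ) + 1) ≠ 0)
      have h3 : ((n : ℂ) + 1) ^ 2 - (y : ℂ) ^ 2 ≠ 0 := by
        rw [show ((n : ℂ) + 1) ^ 2 - (y : ℂ) ^ 2 = -((y + (n + 1)) * (y - (n + 1))) by ring]
        exact neg_ne_zero.2 (mul_ne_zero h1 h2)
      field_simp
      ring
    · have : (y : ℂ) ≠ 0 := by exact_mod_cast hy0.ne'
      push_cast
      field_simp
      ring
  have hnn : 0 ≤ fun p : ℕ × ℕ => ((y / ((p.1 : ℝ) + 1)) ^ 2) ^ (p.2 + 1) :=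
    fun p => by dsimp; positivity
  have hsum : Summable fun p : ℕ × ℕ => ((y / ((p.1 : ℝ) + 1)) ^ 2) ^ (p.2 + 1) := by
    rw [summable_prod_of_nonneg hnn]
    refine ⟨fun n => (hrow n).summable, ?_⟩
    simp_rw [fun n => (hrow n).tsum_eq]
    exact hcol.summable
  have htot := hsum.hasSum.prod_fiberwise hrow
  have heq := htot.unique hcol
  have hswap := hsum.prod_symm.hasSum.prod_fiberwise fun m =>
    (hsum.prod_symm.prod_factor m).hasSum
  have hval : ∑' p : ℕ × ℕ, ((y / ((p.swap.1 : ℝ) + 1)) ^ 2) ^ (p.swap.2 + 1) =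
      (1 - Real.pi * y * Real.cot (Real.pi * y)) / 2 := by
    rw [← heq]
    exact (Equiv.prodComm ℕ ℕ).tsum_eq fun p : ℕ × ℕ => ((y / ((p.1 : ℝ) + 1)) ^ 2) ^ (p.2 + 1)
  rw [hval] at hswap
  convert hswap using 2 with m
  rw [← tsum_mul_right]
  refine tsum_congr fun n => ?_
  simp only [Prod.swap]
  rw [← pow_mul, div_pow]
  ring

/-- The real number `ζ(2n)`. -/
noncomputable def zetaEven (n : ℕ) : ℝ :=
  if n = 0 then -1 / 2 else ∑' k : ℕ, 1 / ((k : ℝ) + 1) ^ (2 * n)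

lemma riemannZeta_two_mul_eq_zetaEven (n : ℕ) : riemannZeta (2 * n) = zetaEven n := by
  rcases Nat.eq_zero_or_pos n with rfl | hn
  · simp [zetaEven, riemannZeta_zero]
  · have h := zeta_eq_tsum_one_div_nat_add_one_cpow (s := 2 * n) (by
      have : (1 : ℝ) ≤ n := by exact_mod_cast hn
      simp; linarith)
    rw [h, zetaEven, if_neg hn.ne', Complex.ofReal_tsum]
    refine tsum_congr fun k => ?_
    push_cast
    rw [show (2 * n : ℂ) = ((2 * n : ℕ) : ℂ) by push_cast; rfl, Complex.cpow_natCast]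

lemma hasSum_zetaEven_mul_pow {y : ℝ} (hy0 : 0 < y) (hy1 : y < 1) :
    HasSum (fun n : ℕ => zetaEven n * y ^ (2 * n))
      (-(Real.pi * y * Real.cot (Real.pi * y)) / 2) := by
  rw [← hasSum_nat_add_iff' 1]
  convert! hasSum_tsum_even_pow_mul_pow hy0 hy1 using 1
  simp [zetaEven]
  ring

lemma abs_zetaEven_le (n : ℕ) : |zetaEven n| ≤ 1 + zetaEven 1 := by
  have hs : ∀ n : ℕ, 0 < n → Summable fun k : ℕ => 1 / ((k : ℝ) + 1) ^ (2 * n) := fun n hn => by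
    simpa using (summable_nat_add_iff 1).2 (Real.summable_one_div_nat_pow.2 (by omega : 1 < 2 * n))
  have h1 : 0 ≤ zetaEven 1 := by
    simp only [zetaEven, one_ne_zero, if_false]; exact tsum_nonneg fun k => by positivity
  rcases Nat.eq_zero_or_pos n with rfl | hn
  · rw [zetaEven, if_pos rfl, abs_of_neg (by norm_num)]; linarith
  · have h0 : 0 ≤ zetaEven n := by
      rw [zetaEven, if_neg hn.ne']; exact tsum_nonneg fun k => by positivity
    have : zetaEven n ≤ zetaEven 1 := by
      rw [zetaEven, zetaEven, if_neg hn.ne', if_neg one_ne_zero]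
      refine (hs n hn).tsum_le_tsum (fun k => ?_) (hs 1 one_pos)
      refine one_div_le_one_div_of_le (by positivity) (pow_le_pow_right₀ ?_ (by omega))
      linarith [(Nat.cast_nonneg k : (0 : ℝ) ≤ k)]
    rw [abs_of_nonneg h0]; linarith

lemma exists_truncT_le (r : ℕ) : ∃ C, ∀ k, truncT r k ≤ C := by
  induction r with
  | zero => exact ⟨1, fun k => by simp [truncT]⟩
  | succ r ih =>
    obtain ⟨C, hC⟩ := ih
    have hs : Summable fun j : ℕ => 1 / (2 * (j : ℝ) + 1) ^ 2 := by
      have h : Summable fun j : ℕ => 1 / (((j + 1 : ℕ) : ℝ)) ^ 2 :=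
        (summable_nat_add_iff 1).2 (Real.summable_one_div_nat_pow.2 one_lt_two)
      refine h.of_nonneg_of_le (fun j => by positivity) fun j => ?_
      refine one_div_le_one_div_of_le (by positivity) (pow_le_pow_left₀ (by positivity) ?_ 2)
      push_cast
      linarith [(Nat.cast_nonneg j : (0 : ℝ) ≤ j)]
    refine ⟨C * ∑' j : ℕ, 1 / (2 * (j : ℝ) + 1) ^ 2, fun k => ?_⟩
    have hC0 : 0 ≤ C := (truncT_nonneg r 0).trans (hC 0)
    calc truncT (r + 1) k ≤ ∑ j ∈ Finset.range k, C * (1 / (2 * (j : ℝ) + 1) ^ 2) := by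
          rw [truncT]
          refine Finset.sum_le_sum fun j _ => ?_
          rw [mul_one_div]
          have := hC j
          gcongr
      _ = C * ∑ j ∈ Finset.range k, 1 / (2 * (j : ℝ) + 1) ^ 2 := by rw [Finset.mul_sum]
      _ ≤ _ := mul_le_mul_of_nonneg_left (hs.sum_le_tsum _ fun j _ => by positivity) hC0

/-- The coefficient of `x ^ (2 * k + 1)` in the Taylor series of `arcsin x`. -/
noncomputable def arcsinCoeff : ℕ → ℝ
  | 0 => 1
  | k + 1 => arcsinCoeff k * (2 * k + 1) ^ 2 / ((2 * k + 3) * (2 * k + 2))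

lemma arcsinCoeff_pos (k : ℕ) : 0 < arcsinCoeff k := by
  induction k with
  | zero => simp [arcsinCoeff]
  | succ k ih => rw [arcsinCoeff]; positivity

lemma arcsinCoeff_le_one (k : ℕ) : arcsinCoeff k ≤ 1 := by
  induction k with
  | zero => simp [arcsinCoeff]
  | succ k ih =>
    rw [arcsinCoeff, div_le_one (by positivity)]
    have := arcsinCoeff_pos k
    have hk := (Nat.cast_nonneg k : (0 : ℝ) ≤ k)
    nlinarith [sq_nonneg (2 * (k : ℝ) + 1)]

lemma integral_sin_pow_odd_half (k : ℕ) :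
    ∫ u in (0 : ℝ)..Real.pi / 2, Real.sin u ^ (2 * k + 1) =
      1 / (arcsinCoeff k * (2 * k + 1) ^ 2) := by
  induction k with
  | zero => simp [arcsinCoeff]
  | succ k ih =>
    rw [show 2 * (k + 1) + 1 = (2 * k + 1) + 2 by ring, integral_sin_pow, ih, arcsinCoeff]
    have := (arcsinCoeff_pos k).ne'
    simp
    field_simp
    ring

/-- A partial sum of a series in odd powers of `sin`. -/
noncomputable def sinSum (t : ℕ → ℝ) (N : ℕ) (u : ℝ) : ℝ :=
  ∑ k ∈ Finset.range N, arcsinCoeff k * t k * Real.sin u ^ (2 * k + 1)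

/-- The derivative of `sinSum`. -/
noncomputable def sinSumDeriv (t : ℕ → ℝ) (N : ℕ) (u : ℝ) : ℝ :=
  ∑ k ∈ Finset.range N, arcsinCoeff k * t k * ((2 * k + 1) * Real.sin u ^ (2 * k) * Real.cos u)

lemma hasDerivAt_sinSum (t : ℕ → ℝ) (N : ℕ) (u : ℝ) :
    HasDerivAt (sinSum t N) (sinSumDeriv t N u) u := by
  unfold sinSum sinSumDeriv
  refine HasDerivAt.fun_sum fun k _ => ?_
  convert! ((Real.hasDerivAt_sin u).fun_pow (2 * k + 1)).const_mul (arcsinCoeff k * t k) using 1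
  push_cast
  simp

lemma hasDerivAt_sinSumDeriv {t t' : ℕ → ℝ}
    (ht : ∀ k : ℕ, t (k + 1) = t k + t' k / (2 * k + 1) ^ 2) (N : ℕ) (u : ℝ) :
    HasDerivAt (sinSumDeriv t N) (sinSum t' N u -
      arcsinCoeff N * t N * ((2 * N + 1) * (2 * N) * Real.sin u ^ (2 * N - 1))) u := by
  induction N with
  | zero => 
    have h0 : sinSumDeriv t 0 = fun _ => 0 := by funext v; simp [sinSumDeriv]
    rw [h0]
    convert! hasDerivAt_const u (0 : ℝ) using 1
    simp [sinSum]
  | succ N ih =>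
    have hfun : sinSumDeriv t (N + 1) = fun u => sinSumDeriv t N u +
        arcsinCoeff N * t N * ((2 * N + 1) * Real.sin u ^ (2 * N) * Real.cos u) := by
      funext v; simp [sinSumDeriv, Finset.sum_range_succ]
    rw [hfun]
    have hd := ih.add (((((Real.hasDerivAt_sin u).fun_pow (2 * N)).const_mul
      (2 * (N : ℝ) + 1)).mul (Real.hasDerivAt_cos u)).const_mul (arcsinCoeff N * t N))
    convert! hd using 1
    rw [ht, arcsinCoeff, sinSum, sinSum, Finset.sum_range_succ]
    rcases N with _ | M
    · simp
      field_simp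
      ring
    · have e1 : 2 * (M + 1) - 1 = 2 * M + 1 := by omega
      have e2 : 2 * (M + 1 + 1) - 1 = 2 * M + 3 := by omega
      rw [e1, e2]
      have hc := Real.cos_sq' u
      push_cast
      have h3 : Real.sin u ^ (2 * (M + 1)) = Real.sin u ^ (2 * M + 1) * Real.sin u := by ring
      have h4 : Real.sin u ^ (2 * M + 3) = Real.sin u ^ (2 * M + 1) * Real.sin u ^ 2 := by ring
      have h5 : Real.sin u ^ (2 * (M + 1) + 1) = Real.sin u ^ (2 * M + 1) * Real.sin u ^ 2 := by
        ring
      rw [h3, h4, h5]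
      field_simp
      ring_nf
      rw [hc]
      ring_nf

lemma abs_le_of_abs_deriv2_le {R R' R'' : ℝ → ℝ} {b e : ℝ} (he : 0 ≤ e)
    (h1 : ∀ x, HasDerivAt R (R' x) x) (h2 : ∀ x, HasDerivAt R' (R'' x) x)
    (hR : R 0 = 0) (hR' : R' 0 = 0) (hb : ∀ x ∈ Set.Icc 0 b, |R'' x| ≤ e) :
    ∀ x ∈ Set.Icc 0 b, |R x| ≤ e * b * b := by
  have hR'b : ∀ x ∈ Set.Icc 0 b, |R' x| ≤ e * b := fun x hx => by
    have := norm_image_sub_le_of_norm_deriv_le_segment' (C := e)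
      (fun x _ => (h2 x).hasDerivWithinAt) (fun x hx => hb x (Set.Ico_subset_Icc_self hx)) x hx
    rw [hR', sub_zero, sub_zero] at this
    exact this.trans (mul_le_mul_of_nonneg_left hx.2 he)
  intro x hx
  have := norm_image_sub_le_of_norm_deriv_le_segment' (C := e * b)
    (fun x _ => (h1 x).hasDerivWithinAt) (fun x hx => hR'b x (Set.Ico_subset_Icc_self hx)) x hx
  rw [hR, sub_zero, sub_zero] at this
  exact this.trans (mul_le_mul_of_nonneg_left hx.2 (mul_nonneg he (hx.1.trans hx.2)))

lemma tendsto_sinSum_remainder (C : ℝ) {q : ℝ} (hq0 : 0 ≤ q) (hq1 : q < 1) :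
    Tendsto (fun N : ℕ => C * ((2 * N + 1) * (2 * N) * q ^ (2 * N - 1))) atTop (𝓝 0) := by
  have h2 := tendsto_pow_const_mul_const_pow_of_lt_one 2 hq0 hq1
  have h1 := tendsto_pow_const_mul_const_pow_of_lt_one 1 hq0 hq1
  have hf : Tendsto (fun n : ℕ => C * (((n : ℝ) ^ 2 * q ^ n) + 3 * ((n : ℝ) ^ 1 * q ^ n) +
      2 * q ^ n)) atTop (𝓝 0) := by
    simpa using ((h2.add (h1.const_mul 3)).add
      ((tendsto_pow_atTop_nhds_zero_of_lt_one hq0 hq1).const_mul 2)).const_mul C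
  have hsub : Tendsto (fun N : ℕ => 2 * N - 1) atTop atTop :=
    tendsto_atTop_mono (fun N => by omega) (tendsto_sub_atTop_nat 1)
  refine (hf.comp hsub).congr' ?_
  filter_upwards [eventually_ge_atTop 1] with N hN
  obtain ⟨M, rfl⟩ := Nat.exists_eq_add_of_le' hN
  have e1 : 2 * (M + 1) - 1 = 2 * M + 1 := by omega
  simp only [Function.comp, e1]
  push_cast
  ring

lemma tendstoUniformlyOn_sinSum {t t' : ℕ → ℝ} {g g' g'' : ℝ → ℝ} {b C : ℝ}
    (ht : ∀ k : ℕ, t (k + 1) = t k + t' k / (2 * k + 1) ^ 2)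
    (ht0 : ∀ k, 0 ≤ t k) (htC : ∀ k, t k ≤ C)
    (hg : ∀ x, HasDerivAt g (g' x) x) (hg' : ∀ x, HasDerivAt g' (g'' x) x)
    (hg0 : g 0 = 0) (hg'0 : g' 0 = t 0) (hb0 : 0 ≤ b) (hb : b < Real.pi / 2)
    (h : TendstoUniformlyOn (sinSum t') g'' atTop (Set.Icc 0 b)) :
    TendstoUniformlyOn (sinSum t) g atTop (Set.Icc 0 b) := by
  rw [Metric.tendstoUniformlyOn_iff] at h ⊢
  intro ε hε
  have hsb0 : 0 ≤ Real.sin b := Real.sin_nonneg_of_nonneg_of_le_pi hb0 (by linarith [Real.pi_pos])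
  have hsb1 : Real.sin b < 1 := by
    rw [← Real.sin_pi_div_two]
    exact Real.sin_lt_sin_of_lt_of_le_pi_div_two (by linarith [Real.pi_pos]) le_rfl hb
  have hC0 : 0 ≤ C := (ht0 0).trans (htC 0)
  set δ := ε / (2 * (b * b + 1)) with hδ
  have hδ0 : 0 < δ := by positivity
  have hrem := (tendsto_sinSum_remainder C hsb0 hsb1).eventually_lt_const hδ0
  filter_upwards [h δ hδ0, hrem, eventually_ge_atTop 1] with N hN hN' hN1 x hx
  have key := abs_le_of_abs_deriv2_le (R := fun x => g x - sinSum t N x) (b := b) (e := 2 * δ)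
    (by positivity)
    (fun x => (hg x).sub (hasDerivAt_sinSum t N x))
    (fun x => (hg' x).sub (hasDerivAt_sinSumDeriv ht N x)) (by simp [hg0, sinSum])
    (by
      obtain ⟨M, rfl⟩ := Nat.exists_eq_add_of_le' hN1
      simp [hg'0, sinSumDeriv, Finset.sum_range_succ', arcsinCoeff])
    (fun x hx => by
      have hs0 : 0 ≤ Real.sin x :=
        Real.sin_nonneg_of_nonneg_of_le_pi hx.1 (by linarith [Real.pi_pos, hx.2])
      have hsb : Real.sin x ≤ Real.sin b := Real.sin_le_sin_of_le_of_le_pi_div_two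
        (by linarith [Real.pi_pos, hx.1]) hb.le hx.2
      have h1 := hN x hx
      rw [Real.dist_eq] at h1
      have h2 : arcsinCoeff N * t N * ((2 * N + 1) * (2 * N) * Real.sin x ^ (2 * N - 1)) ≤
          C * ((2 * N + 1) * (2 * N) * Real.sin b ^ (2 * N - 1)) := by
        have h3 : arcsinCoeff N * t N ≤ C := by
          have := mul_le_mul (arcsinCoeff_le_one N) (htC N) (ht0 N) zero_le_one
          linarith
        gcongr
      have h4 : 0 ≤ arcsinCoeff N * t N * ((2 * N + 1) * (2 * N) * Real.sin x ^ (2 * N - 1)) := by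
        have := (arcsinCoeff_pos N).le
        have := ht0 N
        positivity
      rw [abs_lt] at h1
      rw [abs_le]
      constructor <;> linarith [h1.1, h1.2])
    x hx
  rw [Real.dist_eq]
  refine key.trans_lt ?_
  rw [hδ]
  field_simp
  linarith

lemma tendstoUniformlyOn_sinSum_truncT (r : ℕ) {b : ℝ} (hb0 : 0 ≤ b) (hb : b < Real.pi / 2) :
    TendstoUniformlyOn (sinSum (truncT r)) (fun u => u ^ (2 * r + 1) / (2 * r + 1).factorial)
      atTop (Set.Icc 0 b) := by
  obtain ⟨C, hC⟩ := exists_truncT_le r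
  induction r generalizing C with
  | zero =>
    refine tendstoUniformlyOn_sinSum (t' := fun _ => 0) (g' := fun _ => 1) (g'' := fun _ => 0)
      (by simp [truncT]) (truncT_nonneg 0) hC ?_ (fun x => hasDerivAt_const x 1) (by simp)
      (by simp [truncT]) hb0 hb ?_
    · simpa using fun x : ℝ => hasDerivAt_id' x
    · rw [Metric.tendstoUniformlyOn_iff]
      intro ε hε
      simp [sinSum, hε]
  | succ r ih =>
    obtain ⟨C', hC'⟩ := exists_truncT_le r
    refine tendstoUniformlyOn_sinSum
      (g' := fun u => u ^ (2 * r + 2) / (2 * r + 2).factorial)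
      (fun k => by rw [truncT, truncT, Finset.sum_range_succ]) (truncT_nonneg _) hC ?_ ?_ (by simp)
      (by simp [truncT]) hb0 hb (ih C' hC')
    · intro x
      convert! (hasDerivAt_pow (2 * r + 3) x).div_const (((2 * r + 3).factorial : ℕ) : ℝ) using 1
      rw [Nat.factorial_succ (2 * r + 2)]
      push_cast
      field_simp
      ring_nf
    · intro x
      convert! (hasDerivAt_pow (2 * r + 2) x).div_const (((2 * r + 2).factorial : ℕ) : ℝ) using 1
      rw [Nat.factorial_succ (2 * r + 1)]
      push_cast
      field_simp
      ring_nf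

lemma tendsto_sinSum_truncT (r : ℕ) {u : ℝ} (hu0 : 0 ≤ u) (hu : u < Real.pi / 2) :
    Tendsto (fun N => sinSum (truncT r) N u) atTop
      (𝓝 (u ^ (2 * r + 1) / (2 * r + 1).factorial)) :=
  (tendstoUniformlyOn_sinSum_truncT r hu0 hu).tendsto_at (Set.right_mem_Icc.2 hu0)

lemma integral_sub_mul_cos_mul_sin_pow (k : ℕ) :
    ∫ u in (0 : ℝ)..Real.pi / 2, (Real.pi / 2 - u) * (Real.sin u ^ (2 * k) * Real.cos u) =
      1 / (arcsinCoeff k * (2 * k + 1) ^ 3) := by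
  have h := intervalIntegral.integral_mul_deriv_eq_deriv_mul (a := 0) (b := Real.pi / 2)
    (u := fun u => Real.pi / 2 - u) (v := fun u => Real.sin u ^ (2 * k + 1) / (2 * k + 1))
    (u' := fun _ => -1) (v' := fun u => Real.sin u ^ (2 * k) * Real.cos u)
    (fun x _ => by simpa using (hasDerivAt_id' x).const_sub (Real.pi / 2))
    (fun x _ => by
      convert! ((Real.hasDerivAt_sin x).fun_pow (2 * k + 1)).div_const (2 * (k : ℝ) + 1) using 1
      push_cast
      field_simp)
    (Continuous.intervalIntegrable (by fun_prop) _ _)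
    (Continuous.intervalIntegrable (by fun_prop) _ _)
  rw [h]
  simp only [neg_mul, one_mul, intervalIntegral.integral_neg, intervalIntegral.integral_div,
    integral_sin_pow_odd_half]
  have := (arcsinCoeff_pos k).ne'
  simp
  field_simp

/-- The integrand `(π/2 - u) u^(2r+1) cot u / (2r+1)!`. -/
noncomputable def cotIntegrand (r : ℕ) (u : ℝ) : ℝ :=
  (Real.pi / 2 - u) * Real.cot u * (u ^ (2 * r + 1) / (2 * r + 1).factorial)

lemma hasSum_sin_cotIntegrand (r : ℕ) {u : ℝ} (hu0 : 0 < u) (hu : u < Real.pi / 2) :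
    HasSum (fun k : ℕ => arcsinCoeff k * truncT r k *
      ((Real.pi / 2 - u) * (Real.sin u ^ (2 * k) * Real.cos u))) (cotIntegrand r u) := by
  have hs : 0 < Real.sin u := Real.sin_pos_of_pos_of_lt_pi hu0 (by linarith [Real.pi_pos])
  have hc : 0 < Real.cos u := Real.cos_pos_of_mem_Ioo ⟨by linarith, hu⟩
  rw [hasSum_iff_tendsto_nat_of_nonneg]
  · convert! (tendsto_sinSum_truncT r hu0.le hu).const_mul ((Real.pi / 2 - u) * Real.cot u)
      using 2 with N
    rw [sinSum, Finset.mul_sum]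
    refine Finset.sum_congr rfl fun k _ => ?_
    rw [Real.cot_eq_cos_div_sin]
    field_simp
    ring
  · intro k
    have := (arcsinCoeff_pos k).le
    have := truncT_nonneg r k
    have : 0 ≤ Real.pi / 2 - u := by linarith
    positivity

lemma tsum_truncT_eq_integral (r : ℕ) :
    ∑' k : ℕ, truncT r k / (2 * k + 1) ^ 3 = ∫ u in (0 : ℝ)..Real.pi / 2, cotIntegrand r u := by
  have hpi : (0 : ℝ) ≤ Real.pi / 2 := by positivity
  set F : ℕ → ℝ → ℝ := fun k u => arcsinCoeff k * truncT r k *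
      ((Real.pi / 2 - u) * (Real.sin u ^ (2 * k) * Real.cos u)) with hF
  have hint : ∀ k, ∫ u in Set.Ioo 0 (Real.pi / 2), F k u = truncT r k / (2 * k + 1) ^ 3 := by
    intro k
    rw [← integral_Ioc_eq_integral_Ioo, ← intervalIntegral.integral_of_le hpi,
      intervalIntegral.integral_const_mul, integral_sub_mul_cos_mul_sin_pow]
    have := (arcsinCoeff_pos k).ne'
    field_simp
  have hnorm : ∀ k, ∫ u in Set.Ioo 0 (Real.pi / 2), ‖F k u‖ = truncT r k / (2 * k + 1) ^ 3 := by
    intro k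
    rw [← hint k]
    refine setIntegral_congr_fun measurableSet_Ioo fun u hu => ?_
    have hc : 0 ≤ Real.cos u := Real.cos_nonneg_of_mem_Icc ⟨by linarith [hu.1], hu.2.le⟩
    have hs : 0 ≤ Real.sin u :=
      Real.sin_nonneg_of_nonneg_of_le_pi hu.1.le (by linarith [Real.pi_pos, hu.2])
    have := (arcsinCoeff_pos k).le
    have := truncT_nonneg r k
    have : 0 ≤ Real.pi / 2 - u := by linarith [hu.2]
    simp only [hF]
    rw [Real.norm_of_nonneg (by positivity)]
  have hsum : Summable fun k : ℕ => truncT r k / (2 * (k : ℝ) + 1) ^ 3 := by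
    obtain ⟨C, hC⟩ := exists_truncT_le r
    have h : Summable fun j : ℕ => C * (1 / (((j + 1 : ℕ) : ℝ)) ^ 3) :=
      ((summable_nat_add_iff 1).2 (Real.summable_one_div_nat_pow.2 (by norm_num))).mul_left C
    refine h.of_nonneg_of_le (fun j => div_nonneg (truncT_nonneg r j) (by positivity)) fun j => ?_
    rw [mul_one_div]
    have hC0 : 0 ≤ C := (truncT_nonneg r 0).trans (hC 0)
    refine div_le_div₀ hC0 (hC j) (by positivity) (pow_le_pow_left₀ (by positivity) ?_ 3)
    push_cast
    linarith [(Nat.cast_nonneg j : (0 : ℝ) ≤ j)]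
  have key := hasSum_integral_of_summable_integral_norm (F := F)
    (μ := volume.restrict (Set.Ioo 0 (Real.pi / 2)))
    (fun k => (Continuous.integrableOn_Icc (by fun_prop)).mono_set Set.Ioo_subset_Icc_self)
    (by simpa only [hnorm] using hsum)
  simp only [hint] at key
  rw [key.tsum_eq, intervalIntegral.integral_of_le hpi, integral_Ioc_eq_integral_Ioo]
  exact setIntegral_congr_fun measurableSet_Ioo fun u hu =>
    (hasSum_sin_cotIntegrand r hu.1 hu.2).tsum_eq

lemma integral_one_sub_mul_pow (m : ℕ) :
    ∫ x in (0 : ℝ)..1, (1 - x) * x ^ m = 1 / ((m + 1) * (m + 2)) := by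
  have h : ∀ x : ℝ, (1 - x) * x ^ m = x ^ m - x ^ (m + 1) := fun x => by ring
  simp only [h]
  rw [intervalIntegral.integral_sub (Continuous.intervalIntegrable (by fun_prop) _ _)
    (Continuous.intervalIntegrable (by fun_prop) _ _), integral_pow, integral_pow]
  push_cast
  simp
  field_simp
  ring

lemma tsum_zetaEven_eq_integral (r : ℕ) :
    ∑' n : ℕ, zetaEven n / ((2 * n + 2 * r + 1) * (2 * n + 2 * r + 2) * 2 ^ (2 * n)) =
      ∫ x in (0 : ℝ)..1, (1 - x) * x ^ (2 * r) *
        (-(Real.pi * (x / 2) * Real.cot (Real.pi * (x / 2))) / 2) := by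
  set F : ℕ → ℝ → ℝ := fun n x => zetaEven n / 2 ^ (2 * n) * ((1 - x) * x ^ (2 * n + 2 * r)) with hF
  have hpow : ∀ n : ℕ, ∫ x in Set.Ioo (0 : ℝ) 1, (1 - x) * x ^ (2 * n + 2 * r) =
      1 / ((2 * n + 2 * r + 1) * (2 * n + 2 * r + 2)) := fun n => by
    rw [← integral_Ioc_eq_integral_Ioo, ← intervalIntegral.integral_of_le zero_le_one,
      integral_one_sub_mul_pow]
    push_cast
    rfl
  have hint : ∀ n, ∫ x in Set.Ioo (0 : ℝ) 1, F n x =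
      zetaEven n / ((2 * n + 2 * r + 1) * (2 * n + 2 * r + 2) * 2 ^ (2 * n)) := by
    intro n
    rw [integral_const_mul, hpow]
    field_simp
  have hnorm : ∀ n, ∫ x in Set.Ioo (0 : ℝ) 1, ‖F n x‖ =
      |zetaEven n| / 2 ^ (2 * n) * (1 / ((2 * n + 2 * r + 1) * (2 * n + 2 * r + 2))) := by
    intro n
    rw [← hpow n, ← integral_const_mul]
    refine setIntegral_congr_fun measurableSet_Ioo fun x hx => ?_
    have h1 : 0 ≤ 1 - x := by linarith [hx.2]
    have h2 := hx.1.le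
    simp only [hF]
    rw [norm_mul, Real.norm_of_nonneg (by positivity : 0 ≤ (1 - x) * x ^ (2 * n + 2 * r)),
      norm_div, Real.norm_eq_abs, Real.norm_of_nonneg (by positivity : (0 : ℝ) ≤ 2 ^ (2 * n))]
  have hsum : Summable fun n : ℕ =>
      |zetaEven n| / 2 ^ (2 * n) * (1 / ((2 * n + 2 * r + 1) * (2 * n + 2 * r + 2) : ℝ)) := by
    have hg : Summable fun n : ℕ => (1 + zetaEven 1) * (1 / 4 : ℝ) ^ n :=
      (summable_geometric_of_lt_one (by norm_num) (by norm_num)).mul_left _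
    refine hg.of_nonneg_of_le (fun n => by positivity) fun n => ?_
    have h1 : (1 : ℝ) / ((2 * n + 2 * r + 1) * (2 * n + 2 * r + 2)) ≤ 1 := by
      rw [div_le_one (by positivity)]
      have := (Nat.cast_nonneg n : (0 : ℝ) ≤ n)
      have := (Nat.cast_nonneg r : (0 : ℝ) ≤ r)
      nlinarith
    have h2 : |zetaEven n| / 2 ^ (2 * n) ≤ (1 + zetaEven 1) * (1 / 4 : ℝ) ^ n := by
      rw [pow_mul, one_div, inv_pow, ← div_eq_mul_inv]
      norm_num
      exact div_le_div_of_nonneg_right (abs_zetaEven_le n) (by positivity)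
    calc _ ≤ |zetaEven n| / 2 ^ (2 * n) * 1 := mul_le_mul_of_nonneg_left h1 (by positivity)
      _ ≤ _ := by rwa [mul_one]
  have key := hasSum_integral_of_summable_integral_norm (F := F)
    (μ := volume.restrict (Set.Ioo 0 1))
    (fun k => (Continuous.integrableOn_Icc (by fun_prop)).mono_set Set.Ioo_subset_Icc_self)
    (by simpa only [hnorm] using hsum)
  simp only [hint] at key
  rw [key.tsum_eq, intervalIntegral.integral_of_le zero_le_one, integral_Ioc_eq_integral_Ioo]
  refine setIntegral_congr_fun measurableSet_Ioo fun x hx => ?_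
  have h := (hasSum_zetaEven_mul_pow (y := x / 2) (by linarith [hx.1])
    (by linarith [hx.2])).mul_left ((1 - x) * x ^ (2 * r))
  rw [← h.tsum_eq]
  refine tsum_congr fun n => ?_
  simp only [hF]
  rw [div_pow]
  ring

lemma integral_cotIntegrand_eq (r : ℕ) :
    ∫ u in (0 : ℝ)..Real.pi / 2, cotIntegrand r u =
      -2 / (2 * r + 1).factorial * (Real.pi / 2) ^ (2 * r + 2) *
      ∫ x in (0 : ℝ)..1, (1 - x) * x ^ (2 * r) *
        (-(Real.pi * (x / 2) * Real.cot (Real.pi * (x / 2))) / 2) := by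
  have h := intervalIntegral.smul_integral_comp_mul_left (a := 0) (b := 1) (cotIntegrand r)
    (Real.pi / 2)
  rw [mul_zero, mul_one] at h
  rw [← h, smul_eq_mul, ← intervalIntegral.integral_const_mul,
    ← intervalIntegral.integral_const_mul]
  refine intervalIntegral.integral_congr fun x _ => ?_
  simp only [cotIntegrand]
  rw [show Real.pi * (x / 2) = Real.pi / 2 * x by ring]
  field_simp
  ring

theorem stmt_19 (r : ℕ) :
    (MTV (List.replicate r 2 ++ [3]) : ℂ) =
      (-2 / (Nat.factorial (2 * r + 1) : ℂ)) * ((Real.pi : ℂ) / 2) ^ (2 * r + 2) *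
        ∑' n : ℕ, riemannZeta (2 * n) /
          (((2 * n + 2 * r + 1 : ℕ) : ℂ) * ((2 * n + 2 * r + 2 : ℕ) : ℂ) * 2 ^ (2 * n)) := by
  rw [MTV_replicate_two_append_three, tsum_truncT_eq_integral, integral_cotIntegrand_eq,
    ← tsum_zetaEven_eq_integral]
  simp_rw [riemannZeta_two_mul_eq_zetaEven]
  push_cast
  rfl
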